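/- arXiv:2311.18127 — 4 statements merged into one kernel-verified Lean document; each statement's English description precedes it below -/
import Mathlib

section
/- Every zero of the entire function z ↦ ỹ₁₂(L,z) is real. Equivalently, if μ ∈ ℂ admits a nonzero solution v of ∂ₓv = (−i μ σ₃ + Q(x)) v with v₁(0)+v₂(0) = 0 and v₁(L)+v₂(L) = 0, then μ ∈ ℝ. -/
noncomputable section

/-- The third Pauli matrix. -/
def sigma3 : Matrix (Fin 2) (Fin 2) ℂ := !![1, 0; 0, -1]

/-- The matrix potential `Q(x)`. -/
def Qmat (q : ℝ → ℂ) (x : ℝ) : Matrix (Fin 2) (Fin 2) ℂ :=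
  !![0, q x; (starRingEnd ℂ) (q x), 0]

/-- The similarity transformation matrix `U`. -/
def Umat : Matrix (Fin 2) (Fin 2) ℂ := !![1, 1; -Complex.I, Complex.I]

/-- `Ỹ(x,z) = U Y(x,z) U⁻¹`. -/
def Ytil (Y : ℂ → ℝ → Matrix (Fin 2) (Fin 2) ℂ) (z : ℂ) (x : ℝ) :
    Matrix (Fin 2) (Fin 2) ℂ :=
  Umat * Y z x * Umat⁻¹

/-- A differentiable function with nonnegative derivative and equal values at the endpoints of a
nondegenerate interval has zero derivative at the left endpoint. -/
theorem deriv_left_eq_zero_of_nonneg_of_eq {a b : ℝ} (hab : a < b) {g g' : ℝ → ℝ}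
    (hg : ∀ x, HasDerivAt g (g' x) x) (hg' : ∀ x, 0 ≤ g' x) (heq : g a = g b) : g' a = 0 := by
  have hmono : Monotone g := monotone_of_hasDerivAt_nonneg hg hg'
  have hconst : ∀ x ∈ Set.Icc a b, g x = g a := fun x hx =>
    le_antisymm ((hmono hx.2).trans heq.ge) (hmono hx.1)
  have ha : a ∈ Set.Icc a b := Set.left_mem_Icc.2 hab.le
  exact (uniqueDiffOn_Icc hab a ha).eq_deriv _ (hg a).hasDerivWithinAt
    ((hasDerivWithinAt_const a (Set.Icc a b) (g a)).congr hconst rfl)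

/-- The squared modulus of a differentiable complex curve. -/
theorem HasDerivAt.complex_normSq {f : ℝ → ℂ} {f' : ℂ} {x : ℝ} (hf : HasDerivAt f f' x) :
    HasDerivAt (fun t => Complex.normSq (f t)) (2 * ((f x).re * f'.re + (f x).im * f'.im)) x := by
  have hre : HasDerivAt (fun t => (f t).re) f'.re x :=
    Complex.reCLM.hasFDerivAt.comp_hasDerivAt x hf
  have him : HasDerivAt (fun t => (f t).im) f'.im x :=
    Complex.imCLM.hasFDerivAt.comp_hasDerivAt x hf
  simp only [Complex.normSq_apply]
  exact ((hre.mul hre).add (him.mul him)).congr_deriv (by ring)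

/-- A nonreal spectral parameter `μ` admits no solution of the Dirac system satisfying the boundary
conditions `v₁ + v₂ = 0` at both ends, apart from those vanishing at the left end. -/
theorem dirac_eq_zero_of_im_ne_zero {a b : ℝ} (hab : a < b) {q v w : ℝ → ℂ} {μ : ℂ}
    (hμ : μ.im ≠ 0)
    (hv : ∀ x, HasDerivAt v (-(Complex.I * μ) * v x + q x * w x) x)
    (hw : ∀ x, HasDerivAt w (Complex.I * μ * w x + (starRingEnd ℂ) (q x) * v x) x)
    (ha : v a + w a = 0) (hb : v b + w b = 0) : v a = 0 := by
  have key : ∀ x, HasDerivAt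
      (fun t => (Complex.normSq (v t) - Complex.normSq (w t)) / (2 * μ.im))
      (Complex.normSq (v x) + Complex.normSq (w x)) x := by
    intro x
    refine (((hv x).complex_normSq.sub (hw x).complex_normSq).div_const (2 * μ.im)).congr_deriv ?_
    simp only [Complex.normSq_apply, Complex.add_re, Complex.add_im, Complex.mul_re,
      Complex.mul_im, Complex.neg_re, Complex.neg_im, Complex.I_re, Complex.I_im,
      Complex.conj_re, Complex.conj_im]
    field_simp
    ring
  have h := deriv_left_eq_zero_of_nonneg_of_eq hab key
    (fun x => add_nonneg (Complex.normSq_nonneg _) (Complex.normSq_nonneg _))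
    (by simp [eq_neg_of_add_eq_zero_left ha, eq_neg_of_add_eq_zero_left hb])
  exact Complex.normSq_eq_zero.1 (le_antisymm
    (by linarith [Complex.normSq_nonneg (w a)]) (Complex.normSq_nonneg _))

/-- The inverse of `U`. -/
theorem Umat_inv : Umat⁻¹ = !![1 / 2, Complex.I / 2; 1 / 2, -Complex.I / 2] := by
  apply Matrix.inv_eq_right_inv
  ext i j
  fin_cases i <;> fin_cases j <;> simp [Umat] <;> ring_nf <;> simp

/-- The entry `ỹ₁₂` in terms of the entries of `Y`. -/
theorem Ytil_zero_one (Y : ℂ → ℝ → Matrix (Fin 2) (Fin 2) ℂ) (z : ℂ) (x : ℝ) :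
    Ytil Y z x 0 1 =
      Complex.I / 2 * ((Y z x 0 0 - Y z x 0 1) + (Y z x 1 0 - Y z x 1 1)) := by
  simp only [Ytil, Umat_inv]
  simp [Umat, Matrix.mul_apply, Matrix.vecMul, dotProduct, Fin.sum_univ_two]
  ring

/-- every zero of `z ↦ ỹ₁₂(L,z)` is real. -/
theorem dirichlet_eigenvalues_are_real
    (L : ℝ) (hL : 0 < L)
    (q : ℝ → ℂ) (hq : Continuous q) (hper : ∀ x, q (x + L) = q x)
    (Y : ℂ → ℝ → Matrix (Fin 2) (Fin 2) ℂ)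
    (hY0 : ∀ z, Y z 0 = 1)
    (hODE : ∀ (z : ℂ) (x : ℝ) (i j : Fin 2),
      HasDerivAt (fun t => Y z t i j)
        ((((-(Complex.I * z)) • sigma3 + Qmat q x) * Y z x) i j) x) :
    ∀ μ : ℂ, Ytil Y μ L 0 1 = 0 → μ.im = 0 := by
  intro μ hμ
  by_contra him
  have hL0 : (Y μ L 0 0 - Y μ L 0 1) + (Y μ L 1 0 - Y μ L 1 1) = 0 := by
    simpa [Ytil_zero_one] using hμ
  have h := dirac_eq_zero_of_im_ne_zero (q := q) (v := fun t => Y μ t 0 0 - Y μ t 0 1)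
    (w := fun t => Y μ t 1 0 - Y μ t 1 1) hL him
    (fun x => ((hODE μ x 0 0).sub (hODE μ x 0 1)).congr_deriv (by
      simp [sigma3, Qmat, Matrix.mul_apply, Fin.sum_univ_two]; ring))
    (fun x => ((hODE μ x 1 0).sub (hODE μ x 1 1)).congr_deriv (by
      simp [sigma3, Qmat, Matrix.mul_apply, Fin.sum_univ_two]; ring))
    (by simp [hY0]) hL0
  simp [hY0] at h
end
end

section
/- If μ ∈ ℝ satisfies ỹ₁₂(L,μ) = 0, then μ is a simple zero of the entire function z ↦ ỹ₁₂(L,z); that is, the complex derivative ∂_z ỹ₁₂(L,z) evaluated at z = μ is nonzero. -/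
noncomputable section

/-- `(u, v)` solves the Zakharov–Shabat system `u' = -i z u + q v`, `v' = q̄ u + i z v`. -/
def IsZSSolution (q : ℝ → ℂ) (z : ℂ) (u v : ℝ → ℂ) : Prop :=
  ∀ x, HasDerivAt u (-(Complex.I * z) * u x + q x * v x) x ∧
    HasDerivAt v ((starRingEnd ℂ) (q x) * u x + Complex.I * z * v x) x

namespace IsZSSolution

variable {q : ℝ → ℂ} {z : ℂ} {u v : ℝ → ℂ}

theorem continuous_fst (h : IsZSSolution q z u v) : Continuous u :=
  continuous_iff_continuousAt.2 fun x => (h x).1.continuousAt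

theorem continuous_snd (h : IsZSSolution q z u v) : Continuous v :=
  continuous_iff_continuousAt.2 fun x => (h x).2.continuousAt

/-- Grönwall bound for solutions of the Zakharov–Shabat system. -/
theorem norm_le (h : IsZSSolution q z u v) {L R M : ℝ} (hz : ‖z‖ ≤ R)
    (hM : ∀ x ∈ Set.Icc 0 L, ‖q x‖ ≤ M) {x : ℝ} (hx : x ∈ Set.Icc 0 L) :
    ‖(u x, v x)‖ ≤ ‖(u 0, v 0)‖ * Real.exp ((R + M) * x) := by
  have key := norm_le_gronwallBound_of_norm_deriv_right_le
    (f := fun t => (u t, v t)) (δ := ‖(u 0, v 0)‖) (K := R + M) (ε := 0) (a := 0) (b := L)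
    (f' := fun t => (-(Complex.I * z) * u t + q t * v t,
      (starRingEnd ℂ) (q t) * u t + Complex.I * z * v t))
    (h.continuous_fst.prodMk h.continuous_snd).continuousOn
    (fun t _ => ((h t).1.prodMk (h t).2).hasDerivWithinAt) le_rfl ?_ x hx
  · simpa [gronwallBound_ε0] using key
  · intro t ht
    have hu : ‖u t‖ ≤ ‖(u t, v t)‖ := norm_fst_le (u t, v t)
    have hv : ‖v t‖ ≤ ‖(u t, v t)‖ := norm_snd_le (u t, v t)
    have hq := hM t (Set.Ico_subset_Icc_self ht)
    have hzu := mul_le_mul hz hu (norm_nonneg _) ((norm_nonneg _).trans hz)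
    have hzv := mul_le_mul hz hv (norm_nonneg _) ((norm_nonneg _).trans hz)
    have hqu := mul_le_mul hq hu (norm_nonneg _) ((norm_nonneg _).trans hq)
    have hqv := mul_le_mul hq hv (norm_nonneg _) ((norm_nonneg _).trans hq)
    refine norm_prod_le_iff.2 ⟨(norm_add_le _ _).trans ?_, (norm_add_le _ _).trans ?_⟩ <;>
      simp only [norm_mul, norm_neg, Complex.norm_I, RCLike.norm_conj, one_mul] <;> linarith

/-- For a real spectral parameter the system has a conjugation symmetry. -/
theorem snd_eq_neg_conj_fst {r : ℝ} (h : IsZSSolution q r u v) (hq : Continuous q)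
    (h0 : v 0 = -(starRingEnd ℂ) (u 0)) {x : ℝ} (hx : 0 ≤ x) :
    v x = -(starRingEnd ℂ) (u x) := by
  have hs : IsZSSolution q r (fun t => u t + (starRingEnd ℂ) (v t))
      (fun t => v t + (starRingEnd ℂ) (u t)) := by
    intro t
    constructor
    · refine ((h t).1.add (h t).2.star).congr_deriv ?_
      simp
      ring
    · refine ((h t).2.add (h t).1.star).congr_deriv ?_
      simp
      ring
  obtain ⟨M, hM⟩ := (isCompact_Icc (a := 0) (b := x)).exists_bound_of_continuousOn hq.continuousOn
  have hb := hs.norm_le le_rfl hM (Set.right_mem_Icc.2 hx)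
  simp only [h0, map_neg, Complex.conj_conj, add_neg_cancel, neg_add_cancel, Prod.mk_zero_zero,
    norm_zero, zero_mul] at hb
  have := (Prod.mk.inj (norm_le_zero_iff.1 hb)).2
  exact eq_neg_of_add_eq_zero_left this

/-- The Wronskian of two solutions with spectral parameters `z` and `w`. -/
theorem wronskian_sub {w : ℂ} {a b : ℝ → ℂ} (h : IsZSSolution q z u v)
    (h' : IsZSSolution q w a b) (L : ℝ) :
    (u L * b L - v L * a L) - (u 0 * b 0 - v 0 * a 0) =
      (z - w) * ∫ x in (0 : ℝ)..L, -Complex.I * (u x * b x + v x * a x) := by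
  rw [← intervalIntegral.integral_const_mul]
  symm
  apply intervalIntegral.integral_eq_sub_of_hasDerivAt
    (f := fun x => u x * b x - v x * a x)
  · intro x _
    refine (((h x).1.mul (h' x).2).sub ((h x).2.mul (h' x).1)).congr_deriv ?_
    ring
  · have := h.continuous_fst
    have := h.continuous_snd
    have := h'.continuous_fst
    have := h'.continuous_snd
    exact Continuous.intervalIntegrable (by fun_prop) _ _

end IsZSSolution

theorem hasDerivAt_of_eq_sub_mul {f g : ℂ → ℂ} {c : ℂ} (h : ∀ z, f z = (z - c) * g z)
    (hg : ContinuousAt g c) : HasDerivAt f (g c) c := by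
  rw [hasDerivAt_iff_tendsto_slope]
  refine (hg.tendsto.mono_left nhdsWithin_le_nhds).congr' ?_
  filter_upwards [self_mem_nhdsWithin] with z hz
  have : z - c ≠ 0 := sub_ne_zero.2 hz
  simp [slope_def_field, h, this]

/-- every real zero `μ` of the entire function `z ↦ ỹ₁₂(L,z)` is simple:
the complex derivative `∂_z ỹ₁₂(L,z)` at `z = μ` is nonzero. -/
theorem dirichlet_eigenvalues_are_simple
    (L : ℝ) (hL : 0 < L)
    (q : ℝ → ℂ) (hq : Continuous q) (hper : ∀ x, q (x + L) = q x)
    (Y : ℂ → ℝ → Matrix (Fin 2) (Fin 2) ℂ)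
    (hY0 : ∀ z, Y z 0 = 1)
    (hODE : ∀ (z : ℂ) (x : ℝ) (i j : Fin 2),
      HasDerivAt (fun t => Y z t i j)
        ((((-(Complex.I * z)) • sigma3 + Qmat q x) * Y z x) i j) x)
    (hHol : ∀ (x : ℝ) (i j : Fin 2), Differentiable ℂ (fun z => Y z x i j))
    (μ : ℝ) (hμ : Ytil Y (μ : ℂ) L 0 1 = 0) :
    deriv (fun z => Ytil Y z L 0 1) (μ : ℂ) ≠ 0 := by
  set u : ℂ → ℝ → ℂ := fun z x => Y z x 0 0 - Y z x 0 1 with hu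
  set v : ℂ → ℝ → ℂ := fun z x => Y z x 1 0 - Y z x 1 1 with hv
  have hsol : ∀ z, IsZSSolution q z (u z) (v z) := by
    intro z x
    constructor
    · refine ((hODE z x 0 0).sub (hODE z x 0 1)).congr_deriv ?_
      simp [hu, hv, sigma3, Qmat, Matrix.mul_apply, Fin.sum_univ_two]
      ring
    · refine ((hODE z x 1 0).sub (hODE z x 1 1)).congr_deriv ?_
      simp [hu, hv, sigma3, Qmat, Matrix.mul_apply, Fin.sum_univ_two]
      ring
  have hu0 : ∀ z, u z 0 = 1 := fun z => by simp [hu, hY0]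
  have hv0 : ∀ z, v z 0 = -1 := fun z => by simp [hv, hY0]
  have huz : ∀ x, Differentiable ℂ fun z => u z x := fun x => (hHol x 0 0).sub (hHol x 0 1)
  have hvz : ∀ x, Differentiable ℂ fun z => v z x := fun x => (hHol x 1 0).sub (hHol x 1 1)
  have hYt : ∀ z, Ytil Y z L 0 1 = Complex.I / 2 * (u z L + v z L) :=
    fun z => Ytil_zero_one Y z L
  have hsum : u μ L + v μ L = 0 := by
    simpa [hYt] using hμ
  have huc := (hsol μ).continuous_fst
  have hvc := (hsol μ).continuous_snd
  set g : ℂ → ℂ := fun z => ∫ x in (0 : ℝ)..L, -Complex.I * (u z x * v μ x + v z x * u μ x)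
    with hg
  have hW : ∀ z, v μ L * (u z L + v z L) = (z - μ) * g z := by
    intro z
    rw [hg, ← (hsol z).wronskian_sub (hsol μ) L, hu0, hv0, hu0, hv0,
      eq_neg_of_add_eq_zero_left hsum]
    ring
  have hgc : ContinuousAt g μ := by
    obtain ⟨M, hM⟩ :=
      (isCompact_Icc (a := 0) (b := L)).exists_bound_of_continuousOn hq.continuousOn
    have hM0 : 0 ≤ M := (norm_nonneg _).trans (hM 0 (Set.left_mem_Icc.2 hL.le))
    refine intervalIntegral.continuousAt_of_dominated_interval
      (bound := fun x => Real.exp ((‖(μ : ℂ)‖ + 1 + M) * x) * (‖v μ x‖ + ‖u μ x‖)) ?_ ?_ ?_ ?_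
    · refine Filter.Eventually.of_forall fun z => Continuous.aestronglyMeasurable ?_
      have := (hsol z).continuous_fst
      have := (hsol z).continuous_snd
      fun_prop
    · filter_upwards [Metric.ball_mem_nhds (μ : ℂ) one_pos] with z hz
      refine Filter.Eventually.of_forall fun x hx => ?_
      rw [Set.uIoc_of_le hL.le] at hx
      have hzn : ‖z‖ ≤ ‖(μ : ℂ)‖ + 1 := by
        have h1 := norm_sub_norm_le z μ
        have h2 := mem_ball_iff_norm.1 hz
        linarith
      have hb := (hsol z).norm_le hzn hM (Set.Ioc_subset_Icc_self hx)
      simp only [hu0, hv0, Prod.norm_mk, norm_neg, norm_one, max_self, one_mul, max_le_iff] at hb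
      calc ‖-Complex.I * (u z x * v μ x + v z x * u μ x)‖
          ≤ ‖u z x‖ * ‖v μ x‖ + ‖v z x‖ * ‖u μ x‖ := by
            rw [norm_mul, norm_neg, Complex.norm_I, one_mul, ← norm_mul, ← norm_mul]
            exact norm_add_le _ _
        _ ≤ _ := by
            rw [mul_add]
            gcongr
            exacts [hb.1, hb.2]
    · exact Continuous.intervalIntegrable (by fun_prop) _ _
    · refine Filter.Eventually.of_forall fun x _ => ?_
      have := (huz x).continuous
      have := (hvz x).continuous
      exact Continuous.continuousAt (by fun_prop)
  have hder := hasDerivAt_of_eq_sub_mul hW hgc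
  have hgμ : g μ = ((∫ x in (0 : ℝ)..L, 2 * Complex.normSq (u μ x) : ℝ) : ℂ) * Complex.I := by
    rw [← intervalIntegral.integral_ofReal, ← intervalIntegral.integral_mul_const]
    refine intervalIntegral.integral_congr fun x hx => ?_
    rw [Set.uIcc_of_le hL.le] at hx
    have := (hsol μ).snd_eq_neg_conj_fst hq (by simp [hu0, hv0]) hx.1
    simp only [this, Complex.ofReal_mul, Complex.normSq_eq_conj_mul_self, Complex.ofReal_ofNat]
    ring
  have hpos : 0 < ∫ x in (0 : ℝ)..L, 2 * Complex.normSq (u μ x) := by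
    refine intervalIntegral.integral_pos hL ?_ (fun x _ => ?_)
      ⟨0, Set.left_mem_Icc.2 hL.le, by simp [hu0]⟩
    · have := Complex.continuous_normSq
      exact Continuous.continuousOn (by fun_prop)
    · have := Complex.normSq_nonneg (u μ x)
      positivity
  have hS : DifferentiableAt ℂ (fun z => u z L + v z L) μ := ((huz L).add (hvz L)) μ
  intro h0
  have hS0 : deriv (fun z => u z L + v z L) (μ : ℂ) = 0 := by
    simp only [hYt] at h0
    rw [deriv_const_mul _ hS] at h0
    simpa using h0
  have hval := hder.unique (hS.hasDerivAt.const_mul (v μ L))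
  rw [hS0, mul_zero, hgμ] at hval
  exact mul_ne_zero (Complex.ofReal_ne_zero.2 hpos.ne') Complex.I_ne_zero hval
end
end

section
/- If ζ ∈ ℝ is such that the monodromy matrix satisfies Y(L,ζ) = I (equivalently Ỹ(L,ζ) = I), then Δ(ζ) = 1, Δ'(ζ) = 0 and Δ''(ζ) < 0. In particular, every such periodic eigenvalue is a root of Δ(z) − 1 of multiplicity exactly two. -/
noncomputable section

section FloquetDiscriminant

open scoped Matrix.Norms.Operator
open Matrix Set Filter Topology

/-- A matrix-valued function is differentiable as soon as its entries are. -/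
lemma hasDerivAt_matrix {f : ℝ → Matrix (Fin 2) (Fin 2) ℂ} {f' : Matrix (Fin 2) (Fin 2) ℂ} {x : ℝ}
    (h : ∀ i j, HasDerivAt (fun t => f t i j) (f' i j) x) : HasDerivAt f f' x :=
  hasDerivAt_pi.2 fun i => hasDerivAt_pi.2 fun j => h i j

lemma HasDerivAt.matrix_apply {f : ℝ → Matrix (Fin 2) (Fin 2) ℂ} {f' : Matrix (Fin 2) (Fin 2) ℂ}
    {x : ℝ} (h : HasDerivAt f f' x) (i j : Fin 2) : HasDerivAt (fun t => f t i j) (f' i j) x :=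
  hasDerivAt_pi.1 (hasDerivAt_pi.1 h i) j

/-- Second-order expansion, at small `μ`, of solutions of `M' = μ B M` with `M 0 = 1`. -/
lemma exists_norm_sub_quadratic_le {B K J : ℝ → Matrix (Fin 2) (Fin 2) ℂ} {L : ℝ} (hL : 0 ≤ L)
    (hB : Continuous B) (hK : ∀ x, HasDerivAt K (B x) x) (hK0 : K 0 = 0)
    (hJ : ∀ x, HasDerivAt J (B x * K x) x) (hJ0 : J 0 = 0) :
    ∃ C : ℝ, ∀ (μ : ℂ) (M : ℝ → Matrix (Fin 2) (Fin 2) ℂ), ‖μ‖ ≤ 1 → M 0 = 1 →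
      (∀ x, HasDerivAt M (μ • (B x * M x)) x) →
      ‖M L - (1 + μ • K L + μ ^ 2 • J L)‖ ≤ C * ‖μ‖ ^ 3 := by
  have hJc : Continuous J := continuous_iff_continuousAt.2 fun x => (hJ x).continuousAt
  obtain ⟨b, hb⟩ := isCompact_Icc.exists_bound_of_continuousOn (hB.continuousOn (s := Icc 0 L))
  obtain ⟨c, hc⟩ := isCompact_Icc.exists_bound_of_continuousOn
    ((hB.mul hJc).continuousOn (s := Icc 0 L))
  have hb0 : 0 ≤ b := (norm_nonneg _).trans (hb 0 ⟨le_rfl, hL⟩)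
  refine ⟨gronwallBound 0 b c L, fun μ M hμ hM0 hM => ?_⟩
  have hlin : gronwallBound 0 b (c * ‖μ‖ ^ 3) L = gronwallBound 0 b c L * ‖μ‖ ^ 3 := by
    unfold gronwallBound
    split_ifs <;> ring
  have hR : ∀ x, HasDerivAt (fun t => M t - (1 + μ • K t + μ ^ 2 • J t))
      (μ • (B x * (M x - (1 + μ • K x + μ ^ 2 • J x))) + μ ^ 3 • (B x * J x)) x := by
    intro x
    refine ((hM x).sub ((((hK x).const_smul μ).const_add 1).add
      ((hJ x).const_smul (μ ^ 2)))).congr_deriv ?_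
    simp only [mul_sub, mul_add, mul_one, mul_smul_comm]
    module
  have := norm_le_gronwallBound_of_norm_deriv_right_le (δ := 0) (K := b) (ε := c * ‖μ‖ ^ 3)
    (a := 0) (b := L) (fun x _ => (hR x).continuousAt.continuousWithinAt)
    (fun x _ => (hR x).hasDerivWithinAt) (by simp [hM0, hK0, hJ0]) (fun x hx => ?_) L ⟨hL, le_rfl⟩
  · simpa [hlin] using this
  · have hx' := Ico_subset_Icc_self hx
    refine (norm_add_le _ _).trans (add_le_add ?_ ?_)
    · rw [norm_smul]
      refine (mul_le_of_le_one_left (norm_nonneg _) hμ).trans ((norm_mul_le _ _).trans ?_)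
      gcongr
      exact hb x hx'
    · rw [norm_smul, norm_pow, mul_comm]
      gcongr
      exact hc x hx'

lemma natCast_le_analyticOrderAt_of_isBigO {f : ℂ → ℂ} {z₀ : ℂ} (hf : AnalyticAt ℂ f z₀) {n : ℕ}
    (h : f =O[𝓝 z₀] fun w => (w - z₀) ^ n) : n ≤ analyticOrderAt f z₀ := by
  by_contra! hlt
  obtain ⟨m, hm⟩ := ENat.ne_top_iff_exists.1 hlt.ne_top
  obtain ⟨g, hg, hg0, hfg⟩ := hf.analyticOrderAt_eq_natCast.1 hm.symm
  rw [← hm, Nat.cast_lt] at hlt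
  obtain ⟨k, rfl⟩ := Nat.exists_eq_add_of_lt hlt
  have hgO : g =O[𝓝[≠] z₀] fun w => (w - z₀) ^ (k + 1) := by
    obtain ⟨C, hC⟩ := h.bound
    refine Asymptotics.IsBigO.of_bound C ?_
    filter_upwards [hC.filter_mono nhdsWithin_le_nhds, hfg.filter_mono nhdsWithin_le_nhds,
      self_mem_nhdsWithin] with w hw hfw hne
    have hpos : 0 < ‖w - z₀‖ ^ m := pow_pos (norm_pos_iff.2 (sub_ne_zero.2 hne)) m
    rw [hfw, norm_smul, norm_pow, norm_pow] at hw
    rw [norm_pow]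
    refine le_of_mul_le_mul_left (hw.trans_eq ?_) hpos
    ring
  have hlim : Tendsto (fun w => (w - z₀) ^ (k + 1)) (𝓝[≠] z₀) (𝓝 0) := by
    refine (Continuous.tendsto' (by fun_prop) z₀ 0 (by simp)).mono_left nhdsWithin_le_nhds
  exact hg0 (tendsto_nhds_unique (hg.continuousAt.tendsto.mono_left nhdsWithin_le_nhds)
    (hgO.trans_tendsto hlim))

lemma deriv_eq_of_norm_sub_quadratic_le {f : ℂ → ℂ} (hf : Differentiable ℂ f) {z₀ a c : ℂ} {C : ℝ}
    (h : ∀ w, ‖w - z₀‖ ≤ 1 → ‖f w - (a + c * (w - z₀) ^ 2)‖ ≤ C * ‖w - z₀‖ ^ 3) :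
    f z₀ = a ∧ deriv f z₀ = 0 ∧ deriv (deriv f) z₀ = 2 * c := by
  set g : ℂ → ℂ := fun w => f w - (a + c * (w - z₀) ^ 2) with hg
  have hgd : Differentiable ℂ g := by fun_prop
  have hd : ∀ w, deriv g w = deriv f w - 2 * c * (w - z₀) := fun w =>
    (((hf w).hasDerivAt.sub (((((hasDerivAt_id w).sub_const z₀).pow 2).const_mul c).const_add
      a)).congr_deriv (by simp; ring)).deriv
  have hdd : deriv (deriv g) z₀ = deriv (deriv f) z₀ - 2 * c := by
    rw [funext hd]
    exact (((hf.deriv z₀).hasDerivAt.sub (((hasDerivAt_id z₀).sub_const z₀).const_mul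
      (2 * c))).congr_deriv (by simp)).deriv
  have hO : g =O[𝓝 z₀] fun w => (w - z₀) ^ 3 := by
    refine Asymptotics.IsBigO.of_bound C ?_
    filter_upwards [Metric.ball_mem_nhds z₀ one_pos] with w hw
    rw [norm_pow]
    exact h w (mem_ball_iff_norm.1 hw).le
  have hga := hgd.analyticAt z₀
  have hz := (natCast_le_analyticOrderAt_iff_iteratedDeriv_eq_zero hga).1
    (natCast_le_analyticOrderAt_of_isBigO hga hO)
  have h0 := hz 0 (by norm_num)
  have h1 := hz 1 (by norm_num)
  have h2 := hz 2 (by norm_num)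
  simp only [iteratedDeriv_succ, iteratedDeriv_zero, hdd, hd] at h0 h1 h2
  refine ⟨by simpa [hg, sub_eq_zero] using h0, by simpa using h1, sub_eq_zero.1 h2⟩

lemma trace_primitive_mul {B K J : ℝ → Matrix (Fin 2) (Fin 2) ℂ}
    (hK : ∀ x, HasDerivAt K (B x) x) (hK0 : K 0 = 0)
    (hJ : ∀ x, HasDerivAt J (B x * K x) x) (hJ0 : J 0 = 0) (x : ℝ) :
    (J x).trace = (K x * K x).trace / 2 := by
  have hd : ∀ t, HasDerivAt (fun t => (J t).trace - (K t * K t).trace / 2) 0 t := by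
    intro t
    have hKK := (hK t).mul (hK t)
    have h := (((hJ t).matrix_apply 0 0).add ((hJ t).matrix_apply 1 1)).sub
      (((hKK.matrix_apply 0 0).add (hKK.matrix_apply 1 1)).div_const 2)
    simp only [trace_fin_two]
    refine h.congr_deriv ?_
    simp only [Matrix.add_apply, Matrix.mul_apply, Fin.sum_univ_two]
    ring
  have := is_const_of_deriv_eq_zero (fun t => (hd t).differentiableAt) (fun t => (hd t).deriv) x 0
  simpa [hK0, hJ0, sub_eq_zero] using this

/-- The entrywise primitive, vanishing at `0`, of a matrix-valued function. -/
def matrixPrimitive (B : ℝ → Matrix (Fin 2) (Fin 2) ℂ) (x : ℝ) : Matrix (Fin 2) (Fin 2) ℂ :=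
  Matrix.of fun i j => ∫ t in (0 : ℝ)..x, B t i j

lemma matrixPrimitive_apply (B : ℝ → Matrix (Fin 2) (Fin 2) ℂ) (x : ℝ) (i j : Fin 2) :
    matrixPrimitive B x i j = ∫ t in (0 : ℝ)..x, B t i j := rfl

lemma matrixPrimitive_zero (B : ℝ → Matrix (Fin 2) (Fin 2) ℂ) : matrixPrimitive B 0 = 0 := by
  ext i j
  simp [matrixPrimitive_apply]

lemma hasDerivAt_matrixPrimitive {B : ℝ → Matrix (Fin 2) (Fin 2) ℂ} (hB : Continuous B) (x : ℝ) :
    HasDerivAt (matrixPrimitive B) (B x) x :=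
  hasDerivAt_matrix fun i j => ((hB.matrix_elem i j).integral_hasStrictDerivAt 0 x).hasDerivAt

lemma sigma3_mul_sigma3 : sigma3 * sigma3 = 1 := by
  ext i j
  fin_cases i <;> fin_cases j <;> simp [sigma3]

lemma sigma3_conjTranspose : sigma3ᴴ = sigma3 := by
  ext i j
  fin_cases i <;> fin_cases j <;> simp [sigma3]

lemma conjTranspose_mul_sigma3_add (q : ℝ → ℂ) (x ζ : ℝ) (w : ℂ) :
    ((-(Complex.I * ζ)) • sigma3 + Qmat q x)ᴴ * sigma3
      + sigma3 * ((-(Complex.I * w)) • sigma3 + Qmat q x) = (-(Complex.I * (w - ζ))) • 1 := by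
  ext i j
  fin_cases i <;> fin_cases j <;> simp [sigma3, Qmat, mul_apply, Fin.sum_univ_two] <;> ring

section Solutions

variable {q : ℝ → ℂ} {Y : ℂ → ℝ → Matrix (Fin 2) (Fin 2) ℂ}
  (hODE : ∀ (z : ℂ) (x : ℝ),
    HasDerivAt (Y z) (((-(Complex.I * z)) • sigma3 + Qmat q x) * Y z x) x)

include hODE

lemma hasDerivAt_conjTranspose_sigma3_mul (ζ : ℝ) (w : ℂ) (x : ℝ) :
    HasDerivAt (fun t => sigma3 * (Y ζ t)ᴴ * sigma3 * Y w t)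
      ((-(Complex.I * (w - ζ))) • (sigma3 * (Y ζ x)ᴴ * Y w x)) x := by
  have hstar : HasDerivAt (fun t => (Y ζ t)ᴴ)
      ((Y ζ x)ᴴ * ((-(Complex.I * ζ)) • sigma3 + Qmat q x)ᴴ) x := by
    rw [← conjTranspose_mul]
    exact hasDerivAt_matrix fun i j => ((hODE ζ x).matrix_apply j i).star
  refine (((hstar.const_mul sigma3).mul_const sigma3).mul (hODE w x)).congr_deriv ?_
  calc _ = sigma3 * (Y ζ x)ᴴ * (((-(Complex.I * ζ)) • sigma3 + Qmat q x)ᴴ * sigma3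
      + sigma3 * ((-(Complex.I * w)) • sigma3 + Qmat q x)) * Y w x := by noncomm_ring
    _ = _ := by
      rw [conjTranspose_mul_sigma3_add, mul_smul_comm, mul_one, smul_mul_assoc]

variable (hY0 : ∀ z, Y z 0 = 1)

include hY0

lemma sigma3_conjTranspose_sigma3_mul_self (ζ x : ℝ) :
    sigma3 * (Y ζ x)ᴴ * sigma3 * Y ζ x = 1 := by
  have hd : ∀ t, HasDerivAt (fun t => sigma3 * (Y ζ t)ᴴ * sigma3 * Y ζ t) 0 t := fun t =>
    (hasDerivAt_conjTranspose_sigma3_mul hODE ζ ζ t).congr_deriv (by simp)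
  have := is_const_of_deriv_eq_zero (fun t => (hd t).differentiableAt) (fun t => (hd t).deriv) x 0
  simpa [hY0, sigma3_mul_sigma3] using this

/-- Relative to a real spectral parameter `ζ`, the solution satisfies a linear equation
with small coefficient `w - ζ`. -/
lemma hasDerivAt_relative_solution (ζ : ℝ) (w : ℂ) (x : ℝ) :
    HasDerivAt (fun t => sigma3 * (Y ζ t)ᴴ * sigma3 * Y w t)
      ((-(Complex.I * (w - ζ))) • (sigma3 * (Y ζ x)ᴴ * Y ζ x *
        (sigma3 * (Y ζ x)ᴴ * sigma3 * Y w x))) x := by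
  refine (hasDerivAt_conjTranspose_sigma3_mul hODE ζ w x).congr_deriv ?_
  have h := mul_eq_one_comm.1 (sigma3_conjTranspose_sigma3_mul_self hODE hY0 ζ x)
  rw [← mul_assoc, mul_assoc (sigma3 * (Y ζ x)ᴴ) (Y ζ x), h, mul_one]

lemma trace_sigma3_mul_conjTranspose_mul_self (ζ x : ℝ) :
    (sigma3 * (Y ζ x)ᴴ * Y ζ x).trace = 0 := by
  have h := mul_eq_one_comm.1 (sigma3_conjTranspose_sigma3_mul_self hODE hY0 ζ x)
  have h' : sigma3 * (Y ζ x)ᴴ * Y ζ x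
      = (sigma3 * (Y ζ x)ᴴ * sigma3) * (sigma3 * Y ζ x) := by
    rw [← mul_assoc, mul_assoc _ sigma3 sigma3, sigma3_mul_sigma3, mul_one]
  rw [h', trace_mul_comm, mul_assoc, h]
  simp [sigma3, trace_fin_two]

lemma exists_entries_sigma3_mul_conjTranspose_mul_self (ζ x : ℝ) :
    ∃ p : ℝ, (sigma3 * (Y ζ x)ᴴ * Y ζ x) 0 0 = p ∧
      (sigma3 * (Y ζ x)ᴴ * Y ζ x) 1 0
        = -(starRingEnd ℂ) ((sigma3 * (Y ζ x)ᴴ * Y ζ x) 0 1) ∧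
      ‖(sigma3 * (Y ζ x)ᴴ * Y ζ x) 0 1‖ < p := by
  have htr := trace_sigma3_mul_conjTranspose_mul_self hODE hY0 ζ x
  have hdet : (Y ζ x).det ≠ 0 := by
    intro h0
    have := congrArg det (sigma3_conjTranspose_sigma3_mul_self hODE hY0 ζ x)
    rw [det_mul, h0] at this
    simp at this
  generalize Y ζ x = A at *
  have h00 : (sigma3 * Aᴴ * A) 0 0
      = ((Complex.normSq (A 0 0) + Complex.normSq (A 1 0) : ℝ) : ℂ) := by
    simp [sigma3, mul_apply, vecMul, dotProduct, Fin.sum_univ_two, Complex.normSq_eq_conj_mul_self]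
  have h11 : (sigma3 * Aᴴ * A) 1 1
      = -((Complex.normSq (A 0 1) + Complex.normSq (A 1 1) : ℝ) : ℂ) := by
    simp [sigma3, mul_apply, vecMul, dotProduct, Fin.sum_univ_two, Complex.normSq_eq_conj_mul_self]
  have h01 : (sigma3 * Aᴴ * A) 0 1
      = (starRingEnd ℂ) (A 0 0) * A 0 1 + (starRingEnd ℂ) (A 1 0) * A 1 1 := by
    simp [sigma3, mul_apply, vecMul, dotProduct, Fin.sum_univ_two]
  have h10 : (sigma3 * Aᴴ * A) 1 0
      = -((starRingEnd ℂ) (A 0 1) * A 0 0 + (starRingEnd ℂ) (A 1 1) * A 1 0) := by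
    simp [sigma3, mul_apply, vecMul, dotProduct, Fin.sum_univ_two]
  rw [trace_fin_two, h00, h11, ← sub_eq_add_neg, sub_eq_zero, Complex.ofReal_inj] at htr
  refine ⟨_, h00, ?_, ?_⟩
  · rw [h10, h01]
    simp
    ring
  · refine lt_of_pow_lt_pow_left₀ 2
      (add_nonneg (Complex.normSq_nonneg _) (Complex.normSq_nonneg _)) ?_
    rw [h01, ← Complex.normSq_eq_norm_sq]
    have hpos := Complex.normSq_pos.2 hdet
    rw [pow_two]
    nth_rewrite 2 [htr]
    rw [det_fin_two] at hpos
    simp only [Complex.normSq_apply, Complex.add_re, Complex.add_im, Complex.sub_re,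
      Complex.sub_im, Complex.mul_re, Complex.mul_im, Complex.conj_re, Complex.conj_im] at hpos ⊢
    linarith

end Solutions

/-- The primitive of a traceless matrix function with real, strictly dominant diagonal and
skew-conjugate off-diagonal entries is traceless with a square of positive trace. -/
lemma exists_trace_sq_matrixPrimitive_pos {B : ℝ → Matrix (Fin 2) (Fin 2) ℂ} (hB : Continuous B)
    {L : ℝ} (hL : 0 < L) (htr : ∀ x, (B x).trace = 0) {p : ℝ → ℝ}
    (h00 : ∀ x, B x 0 0 = p x) (h10 : ∀ x, B x 1 0 = -(starRingEnd ℂ) (B x 0 1))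
    (hlt : ∀ x, ‖B x 0 1‖ < p x) :
    (matrixPrimitive B L).trace = 0 ∧
      ∃ s : ℝ, 0 < s ∧ (matrixPrimitive B L * matrixPrimitive B L).trace = 2 * s := by
  have hp : Continuous p := by
    have : p = fun x => (B x 0 0).re := funext fun x => by simp [h00]
    rw [this]
    exact Complex.continuous_re.comp (hB.matrix_elem 0 0)
  have hr : Continuous fun x => B x 0 1 := hB.matrix_elem 0 1
  have h11 : ∀ x, B x 1 1 = -(p x : ℂ) := fun x => by
    have := htr x
    rw [trace_fin_two, h00] at this
    linear_combination this
  have k00 : matrixPrimitive B L 0 0 = ((∫ x in (0 : ℝ)..L, p x : ℝ) : ℂ) := by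
    simp only [matrixPrimitive_apply, h00, intervalIntegral.integral_ofReal]
  have k11 : matrixPrimitive B L 1 1 = -((∫ x in (0 : ℝ)..L, p x : ℝ) : ℂ) := by
    simp only [matrixPrimitive_apply, h11, intervalIntegral.integral_neg,
      intervalIntegral.integral_ofReal]
  have k10 : matrixPrimitive B L 1 0 = -(starRingEnd ℂ) (matrixPrimitive B L 0 1) := by
    simp only [matrixPrimitive_apply, h10, intervalIntegral.integral_neg,
      intervalIntegral.intervalIntegral_conj]
  have hK : ‖matrixPrimitive B L 0 1‖ < ∫ x in (0 : ℝ)..L, p x :=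
    (intervalIntegral.norm_integral_le_integral_norm hL.le).trans_lt
      (intervalIntegral.integral_lt_integral_of_continuousOn_of_le_of_exists_lt hL
        hr.norm.continuousOn hp.continuousOn (fun x _ => (hlt x).le)
        ⟨0, ⟨le_rfl, hL.le⟩, hlt 0⟩)
  refine ⟨by rw [trace_fin_two, k00, k11, add_neg_cancel],
    (∫ x in (0 : ℝ)..L, p x) ^ 2 - ‖matrixPrimitive B L 0 1‖ ^ 2, ?_, ?_⟩
  · exact sub_pos.2 (pow_lt_pow_left₀ hK (norm_nonneg _) two_ne_zero)
  · have hn := Complex.mul_conj' (matrixPrimitive B L 0 1)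
    simp only [trace_fin_two, mul_apply, Fin.sum_univ_two, k00, k11, k10]
    push_cast
    linear_combination (-2) * hn

lemma norm_entry_le (A : Matrix (Fin 2) (Fin 2) ℂ) (i j : Fin 2) : ‖A i j‖ ≤ ‖A‖ := by
  rw [← coe_nnnorm, ← coe_nnnorm, NNReal.coe_le_coe, linfty_opNNNorm_def]
  exact (Finset.single_le_sum (f := fun j => ‖A i j‖₊) (fun _ _ => zero_le)
    (Finset.mem_univ j)).trans (Finset.le_sup (f := fun i => ∑ j, ‖A i j‖₊) (Finset.mem_univ i))

lemma norm_trace_half_le (A : Matrix (Fin 2) (Fin 2) ℂ) : ‖A.trace / 2‖ ≤ ‖A‖ := by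
  have h := norm_add_le (A 0 0) (A 1 1)
  have h0 := norm_entry_le A 0 0
  have h1 := norm_entry_le A 1 1
  rw [trace_fin_two, norm_div, Complex.norm_ofNat]
  linarith

end FloquetDiscriminant

open scoped Matrix Matrix.Norms.Operator in
open Matrix in
/-- if `Y(L,ζ) = I` for a real `ζ`, then `Δ(ζ) = 1`, `Δ'(ζ) = 0` and
`Δ''(ζ) < 0` (in particular `Δ''(ζ)` is real), so `ζ` is a root of `Δ − 1` of multiplicity
exactly two. -/
theorem periodic_eigenvalue_double_root
    (L : ℝ) (hL : 0 < L)
    (q : ℝ → ℂ) (hq : Continuous q) (hper : ∀ x, q (x + L) = q x)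
    (Y : ℂ → ℝ → Matrix (Fin 2) (Fin 2) ℂ)
    (hY0 : ∀ z, Y z 0 = 1)
    (hODE : ∀ (z : ℂ) (x : ℝ) (i j : Fin 2),
      HasDerivAt (fun t => Y z t i j)
        ((((-(Complex.I * z)) • sigma3 + Qmat q x) * Y z x) i j) x)
    (hHol : ∀ (x : ℝ) (i j : Fin 2), Differentiable ℂ (fun z => Y z x i j))
    (ζ : ℝ) (hζ : Y (ζ : ℂ) L = 1) :
    ((Y (ζ : ℂ) L).trace / 2 = 1)
    ∧ deriv (fun w => (Y w L).trace / 2) (ζ : ℂ) = 0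
    ∧ ((deriv (deriv (fun w => (Y w L).trace / 2)) (ζ : ℂ)).im = 0)
    ∧ ((deriv (deriv (fun w => (Y w L).trace / 2)) (ζ : ℂ)).re < 0) := by
  have hODE' : ∀ z x, HasDerivAt (Y z) (((-(Complex.I * z)) • sigma3 + Qmat q x) * Y z x) x :=
    fun z x => hasDerivAt_matrix (hODE z x)
  have hYc : Continuous (Y ζ) := continuous_iff_continuousAt.2 fun x => (hODE' ζ x).continuousAt
  set B : ℝ → Matrix (Fin 2) (Fin 2) ℂ := fun x => sigma3 * (Y ζ x)ᴴ * Y ζ x with hBdef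
  have hB : Continuous B := (continuous_const.mul hYc.matrix_conjTranspose).mul hYc
  choose p h00 h10 hlt using exists_entries_sigma3_mul_conjTranspose_mul_self hODE' hY0 ζ
  obtain ⟨htrK, s, hs, htrKK⟩ := exists_trace_sq_matrixPrimitive_pos hB hL
    (trace_sigma3_mul_conjTranspose_mul_self hODE' hY0 ζ) h00 h10 hlt
  have hK := hasDerivAt_matrixPrimitive hB
  have hBK : Continuous fun x => B x * matrixPrimitive B x :=
    hB.mul (continuous_iff_continuousAt.2 fun x => (hK x).continuousAt)
  have hJ := hasDerivAt_matrixPrimitive hBK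
  have htrJ := trace_primitive_mul hK (matrixPrimitive_zero B) hJ (matrixPrimitive_zero _) L
  obtain ⟨C, hC⟩ := exists_norm_sub_quadratic_le hL.le hB hK (matrixPrimitive_zero B) hJ
    (matrixPrimitive_zero _)
  have hdiff : Differentiable ℂ fun w => (Y w L).trace / 2 := by
    simp only [trace_fin_two]
    exact ((hHol L 0 0).add (hHol L 1 1)).div_const 2
  have key : ∀ w : ℂ, ‖w - ζ‖ ≤ 1 →
      ‖(Y w L).trace / 2 - (1 + (-(s : ℂ) / 2) * (w - ζ) ^ 2)‖ ≤ C * ‖w - ζ‖ ^ 3 := by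
    intro w hw
    have hμ : ‖-(Complex.I * (w - ζ))‖ = ‖w - ζ‖ := by simp
    have h := hC (-(Complex.I * (w - ζ))) (fun t => sigma3 * (Y ζ t)ᴴ * sigma3 * Y w t)
      (hμ.trans_le hw) (by simp [hY0, sigma3_mul_sigma3])
      (hasDerivAt_relative_solution hODE' hY0 ζ w)
    simp only [hζ, conjTranspose_one, mul_one, sigma3_mul_sigma3, one_mul, hμ] at h
    refine (le_of_eq ?_).trans ((norm_trace_half_le _).trans h)
    congr 1
    simp only [trace_sub, trace_add, trace_smul, htrK, htrJ, htrKK, trace_one, smul_eq_mul,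
      Fintype.card_fin]
    push_cast
    linear_combination (s : ℂ) / 2 * (w - ζ) ^ 2 * Complex.I_sq
  obtain ⟨h0, h1, h2⟩ := deriv_eq_of_norm_sub_quadratic_le hdiff key
  have h2' : deriv (deriv fun w => (Y w L).trace / 2) (ζ : ℂ) = ((-s : ℝ) : ℂ) := by
    rw [h2]
    push_cast
    ring
  refine ⟨h0, h1, ?_, ?_⟩
  · rw [h2', Complex.ofReal_im]
  · rw [h2', Complex.ofReal_re]
    exact neg_lt_zero.2 hs
end
end

section
/- For every z ∈ ℝ such that Δ(z) is real with −1 < Δ(z) < 1 (i.e. z lies in the interior of a spectral band), the derivative of the Floquet discriminant does not vanish: Δ'(z) ≠ 0. -/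
noncomputable section

/-- `(u, v)` solves on `ℝ` the scalar form of the Zakharov–Shabat system with potential `q`,
spectral parameter `z` and forcing term `(f, g)`. -/
structure SolvesForcedZS (q : ℝ → ℂ) (z : ℂ) (f g u v : ℝ → ℂ) : Prop where
  fst : ∀ x, HasDerivAt u (-(Complex.I * z) * u x + q x * v x + f x) x
  snd : ∀ x, HasDerivAt v ((starRingEnd ℂ) (q x) * u x + Complex.I * z * v x + g x) x

/-- A Grönwall estimate for the forced Zakharov–Shabat system. -/
theorem SolvesForcedZS.norm_le {q : ℝ → ℂ} {z : ℂ} {f g u v : ℝ → ℂ} {B δ ε L : ℝ}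
    (h : SolvesForcedZS q z f g u v) (hδ : 0 ≤ δ) (hε : 0 ≤ ε)
    (hB : ∀ x ∈ Set.Icc 0 L, ‖q x‖ ≤ B)
    (hf : ∀ x ∈ Set.Icc 0 L, ‖f x‖ ≤ ε) (hg : ∀ x ∈ Set.Icc 0 L, ‖g x‖ ≤ ε)
    (hu : ‖u 0‖ ≤ δ) (hv : ‖v 0‖ ≤ δ) {R : ℝ} (hR : ‖z‖ ≤ R) :
    ∀ x ∈ Set.Icc 0 L, ‖u x‖ ≤ gronwallBound δ (R + B) ε L ∧
      ‖v x‖ ≤ gronwallBound δ (R + B) ε L := by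
  intro x hx
  have hB0 : 0 ≤ B := (norm_nonneg _).trans (hB x hx)
  have hR0 : 0 ≤ R := (norm_nonneg _).trans hR
  have hd : ∀ t, HasDerivAt (fun t => (u t, v t)) (-(Complex.I * z) * u t + q t * v t + f t,
      (starRingEnd ℂ) (q t) * u t + Complex.I * z * v t + g t) t :=
    fun t => (h.fst t).prodMk (h.snd t)
  have key := norm_le_gronwallBound_of_norm_deriv_right_le (a := 0) (b := L) (δ := δ)
    (K := R + B) (ε := ε)
    (fun t _ => (hd t).continuousAt.continuousWithinAt) (fun t _ => (hd t).hasDerivWithinAt)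
    (by simpa [Prod.norm_def] using ⟨hu, hv⟩) ?_ x hx
  · have hm : gronwallBound δ (R + B) ε (x - 0) ≤ gronwallBound δ (R + B) ε L :=
      gronwallBound_mono hδ hε (by positivity) (by linarith [hx.2])
    have := key.trans hm
    simpa [Prod.norm_def] using this
  · intro t ht
    have ht' : t ∈ Set.Icc 0 L := ⟨ht.1, ht.2.le⟩
    have h1 : ‖u t‖ ≤ ‖(u t, v t)‖ := le_max_left _ _
    have h2 : ‖v t‖ ≤ ‖(u t, v t)‖ := le_max_right _ _
    have hq := hB t ht'
    refine max_le ?_ ?_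
    · calc ‖-(Complex.I * z) * u t + q t * v t + f t‖
          ≤ ‖z‖ * ‖u t‖ + ‖q t‖ * ‖v t‖ + ‖f t‖ := by
            refine (norm_add₃_le).trans (by simp)
        _ ≤ R * ‖(u t, v t)‖ + B * ‖(u t, v t)‖ + ε := by gcongr; exact hf t ht'
        _ = _ := by ring
    · calc ‖(starRingEnd ℂ) (q t) * u t + Complex.I * z * v t + g t‖
          ≤ ‖q t‖ * ‖u t‖ + ‖z‖ * ‖v t‖ + ‖g t‖ := by
            refine (norm_add₃_le).trans (by simp)
        _ ≤ B * ‖(u t, v t)‖ + R * ‖(u t, v t)‖ + ε := by gcongr; exact hg t ht'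
        _ = _ := by ring

/-- Solutions at nearby spectral parameters with the same initial value are uniformly bounded. -/
theorem exists_bound_of_solvesZS {q : ℝ → ℂ} (hq : Continuous q) {u v : ℂ → ℝ → ℂ} (L : ℝ)
    (h : ∀ w, SolvesForcedZS q w 0 0 (u w) (v w)) (hu : ∀ w, ‖u w 0‖ ≤ 1)
    (hv : ∀ w, ‖v w 0‖ ≤ 1) (z : ℂ) :
    ∃ C, 0 ≤ C ∧ ∀ w ∈ Metric.ball z 1, ∀ x ∈ Set.Icc 0 L, ‖u w x‖ ≤ C ∧ ‖v w x‖ ≤ C := by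
  obtain ⟨B, hB⟩ := (isCompact_Icc (a := (0 : ℝ)) (b := L)).exists_bound_of_continuousOn
    hq.continuousOn
  refine ⟨gronwallBound 1 (‖z‖ + 1 + B) 0 L, ?_, fun w hw => ?_⟩
  · rw [gronwallBound_ε0]; positivity
  · refine (h w).norm_le zero_le_one le_rfl hB (by simp) (by simp) (hu w) (hv w) ?_
    have := norm_le_norm_add_norm_sub' w z
    rw [mem_ball_iff_norm] at hw
    linarith

/-- Solutions with a fixed initial value depend continuously on the spectral parameter. -/
theorem continuousAt_of_solvesZS {q : ℝ → ℂ} (hq : Continuous q) {u v : ℂ → ℝ → ℂ} {L : ℝ}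
    (h : ∀ w, SolvesForcedZS q w 0 0 (u w) (v w)) {a b : ℂ} (ha : ‖a‖ ≤ 1) (hb : ‖b‖ ≤ 1)
    (hu : ∀ w, u w 0 = a) (hv : ∀ w, v w 0 = b) (z : ℂ) {x : ℝ} (hx : x ∈ Set.Icc 0 L) :
    ContinuousAt (fun w => u w x) z ∧ ContinuousAt (fun w => v w x) z := by
  obtain ⟨B, hB⟩ := (isCompact_Icc (a := (0 : ℝ)) (b := L)).exists_bound_of_continuousOn
    hq.continuousOn
  obtain ⟨C, hC0, hC⟩ := exists_bound_of_solvesZS hq L h (fun w => by rwa [hu])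
    (fun w => by rwa [hv]) z
  have hdiff : ∀ w ∈ Metric.ball z 1, ‖u w x - u z x‖ ≤ gronwallBound 0 (‖z‖ + B) (‖w - z‖ * C) L ∧
      ‖v w x - v z x‖ ≤ gronwallBound 0 (‖z‖ + B) (‖w - z‖ * C) L := by
    intro w hw
    have hs : SolvesForcedZS q z (fun t => -(Complex.I * (w - z)) * u w t)
        (fun t => Complex.I * (w - z) * v w t)
        (fun t => u w t - u z t) (fun t => v w t - v z t) := by
      refine ⟨fun t => ?_, fun t => ?_⟩
      · refine (((h w).fst t).sub ((h z).fst t)).congr_deriv ?_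
        simp only [Pi.zero_apply]; ring
      · refine (((h w).snd t).sub ((h z).snd t)).congr_deriv ?_
        simp only [Pi.zero_apply]; ring
    refine hs.norm_le le_rfl (by positivity) hB ?_ ?_ (by simp [hu]) (by simp [hv]) le_rfl x hx
    · intro t ht
      rw [norm_mul, norm_neg, norm_mul, Complex.norm_I, one_mul]
      gcongr
      exact (hC w hw t ht).1
    · intro t ht
      rw [norm_mul, norm_mul, Complex.norm_I, one_mul]
      gcongr
      exact (hC w hw t ht).2
  have hlim : Filter.Tendsto (fun w => gronwallBound 0 (‖z‖ + B) (‖w - z‖ * C) L) (nhds z)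
      (nhds 0) := by
    have hc : Continuous fun w => gronwallBound 0 (‖z‖ + B) (‖w - z‖ * C) L :=
      (gronwallBound_continuous_ε _ _ _).comp (by fun_prop)
    have := hc.tendsto z
    simpa [gronwallBound_ε0_δ0] using this
  have hball := Metric.ball_mem_nhds z one_pos
  constructor
  · rw [ContinuousAt, tendsto_iff_norm_sub_tendsto_zero]
    exact squeeze_zero' (.of_forall fun _ => norm_nonneg _)
      (Filter.mem_of_superset hball fun w hw => (hdiff w hw).1) hlim
  · rw [ContinuousAt, tendsto_iff_norm_sub_tendsto_zero]
    exact squeeze_zero' (.of_forall fun _ => norm_nonneg _)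
      (Filter.mem_of_superset hball fun w hw => (hdiff w hw).2) hlim

theorem SolvesForcedZS.det_eq {q : ℝ → ℂ} {z : ℂ} {a b c d : ℝ → ℂ}
    (h₁ : SolvesForcedZS q z 0 0 a b) (h₂ : SolvesForcedZS q z 0 0 c d) (x : ℝ) :
    a x * d x - b x * c x = a 0 * d 0 - b 0 * c 0 := by
  have hd : ∀ t, HasDerivAt (fun t => a t * d t - b t * c t) 0 t := by
    intro t
    refine (((h₁.fst t).mul (h₂.snd t)).sub ((h₁.snd t).mul (h₂.fst t))).congr_deriv ?_
    simp only [Pi.zero_apply]; ring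
  exact is_const_of_deriv_eq_zero (fun t => (hd t).differentiableAt) (fun t => (hd t).deriv) x 0

/-- For a real spectral parameter the second column of the fundamental matrix is the conjugate
reflection of the first. -/
theorem SolvesForcedZS.conj_symm {q : ℝ → ℂ} (hq : Continuous q) {z L : ℝ} {a b c d : ℝ → ℂ}
    (h₁ : SolvesForcedZS q z 0 0 a b) (h₂ : SolvesForcedZS q z 0 0 c d)
    (ha : a 0 = 1) (hb : b 0 = 0) (hc : c 0 = 0) (hd : d 0 = 1) {x : ℝ}
    (hx : x ∈ Set.Icc 0 L) :
    d x = (starRingEnd ℂ) (a x) ∧ c x = (starRingEnd ℂ) (b x) := by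
  obtain ⟨B, hB⟩ := (isCompact_Icc (a := (0 : ℝ)) (b := L)).exists_bound_of_continuousOn
    hq.continuousOn
  have hs : SolvesForcedZS q z 0 0 (fun t => c t - (starRingEnd ℂ) (b t))
      (fun t => d t - (starRingEnd ℂ) (a t)) := by
    refine ⟨fun t => ?_, fun t => ?_⟩
    · refine ((h₂.fst t).sub (h₁.snd t).star).congr_deriv ?_
      simp [← starRingEnd_apply]; ring
    · refine ((h₂.snd t).sub (h₁.fst t).star).congr_deriv ?_
      simp [← starRingEnd_apply]; ring
  have := hs.norm_le le_rfl le_rfl hB (by simp) (by simp) (by simp [hb, hc]) (by simp [ha, hd])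
    le_rfl x hx
  simpa [gronwallBound_ε0_δ0, sub_eq_zero, and_comm] using this

/-- Variation of the trace of the monodromy matrix `[[a L, c L], [b L, d L]]` with respect to the
spectral parameter. -/
theorem hasDerivAt_trace_of_solvesZS {q : ℝ → ℂ} (hq : Continuous q) {a b c d : ℂ → ℝ → ℂ} {L : ℝ}
    (hL : 0 < L)
    (h₁ : ∀ w, SolvesForcedZS q w 0 0 (a w) (b w)) (h₂ : ∀ w, SolvesForcedZS q w 0 0 (c w) (d w))
    (ha : ∀ w, a w 0 = 1) (hb : ∀ w, b w 0 = 0) (hc : ∀ w, c w 0 = 0) (hd : ∀ w, d w 0 = 1)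
    (z : ℂ) :
    HasDerivAt (fun w => a w L + d w L)
      (-Complex.I * ∫ x in 0..L, ((a z L - d z L) * (a z x * d z x + b z x * c z x)
        - 2 * c z L * (a z x * b z x) + 2 * b z L * (c z x * d z x))) z := by
  have cont₁ : ∀ w, Continuous (a w) ∧ Continuous (b w) := fun w =>
    ⟨continuous_iff_continuousAt.2 fun x => ((h₁ w).fst x).continuousAt,
      continuous_iff_continuousAt.2 fun x => ((h₁ w).snd x).continuousAt⟩
  have cont₂ : ∀ w, Continuous (c w) ∧ Continuous (d w) := fun w =>
    ⟨continuous_iff_continuousAt.2 fun x => ((h₂ w).fst x).continuousAt,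
      continuous_iff_continuousAt.2 fun x => ((h₂ w).snd x).continuousAt⟩
  have hca : ∀ w, Continuous (a w) := fun w => (cont₁ w).1
  have hcb : ∀ w, Continuous (b w) := fun w => (cont₁ w).2
  have hcc : ∀ w, Continuous (c w) := fun w => (cont₂ w).1
  have hcd : ∀ w, Continuous (d w) := fun w => (cont₂ w).2
  have hdet : a z L * d z L - b z L * c z L = 1 := by
    simp [(h₁ z).det_eq (h₂ z) L, ha, hb, hc, hd]
  let F : ℂ → ℝ → ℂ := fun w x =>
    a z L * (d z x * a w x + c z x * b w x) - c z L * (b z x * a w x + a z x * b w x)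
      + b z L * (d z x * c w x + c z x * d w x) - d z L * (b z x * c w x + a z x * d w x)
  have hF : ∀ w, Continuous (F w) := fun w => by
    have := hca w; have := hcb w; have := hcc w; have := hcd w
    have := hca z; have := hcb z; have := hcc z; have := hcd z
    fun_prop
  have hvar : ∀ w, a w L + d w L - (a z L + d z L) =
      (w - z) * (-Complex.I * ∫ x in 0..L, F w x) := by
    intro w
    have hP : ∀ x, HasDerivAt (fun x =>
        a z L * (d z x * a w x - c z x * b w x) + c z L * (-(b z x * a w x) + a z x * b w x)
        + b z L * (d z x * c w x - c z x * d w x) + d z L * (-(b z x * c w x) + a z x * d w x))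
        ((w - z) * -Complex.I * F w x) x := by
      intro x
      have A := (h₁ w).fst x
      have B := (h₁ w).snd x
      have C := (h₂ w).fst x
      have D := (h₂ w).snd x
      have a' := (h₁ z).fst x
      have b' := (h₁ z).snd x
      have c' := (h₂ z).fst x
      have d' := (h₂ z).snd x
      refine (((((d'.mul A).sub (c'.mul B)).const_mul (a z L)).add
        (((b'.mul A).neg.add (a'.mul B)).const_mul (c z L))).add
        (((d'.mul C).sub (c'.mul D)).const_mul (b z L))).add
        (((b'.mul C).neg.add (a'.mul D)).const_mul (d z L)) |>.congr_deriv ?_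
      simp only [Pi.zero_apply, F]; ring
    have hint := intervalIntegral.integral_eq_sub_of_hasDerivAt (a := 0) (b := L)
      (fun x _ => hP x) (((hF w).const_mul _).intervalIntegrable _ _)
    rw [intervalIntegral.integral_const_mul] at hint
    rw [← mul_assoc, hint]
    simp only [ha, hb, hc, hd]
    linear_combination (-(a w L + d w L)) * hdet
  have hG : ContinuousAt (fun w => -Complex.I * ∫ x in 0..L, F w x) z := by
    refine continuousAt_const.mul ?_
    obtain ⟨C₁, hC₁, hab⟩ := exists_bound_of_solvesZS hq L h₁ (by simp [ha]) (by simp [hb]) z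
    obtain ⟨C₂, hC₂, hcd'⟩ := exists_bound_of_solvesZS hq L h₂ (by simp [hc]) (by simp [hd]) z
    refine intervalIntegral.continuousAt_of_dominated_interval
      (bound := fun x => ‖a z L‖ * (‖d z x‖ * C₁ + ‖c z x‖ * C₁)
        + ‖c z L‖ * (‖b z x‖ * C₁ + ‖a z x‖ * C₁)
        + ‖b z L‖ * (‖d z x‖ * C₂ + ‖c z x‖ * C₂)
        + ‖d z L‖ * (‖b z x‖ * C₂ + ‖a z x‖ * C₂))
      (.of_forall fun w => (hF w).aestronglyMeasurable) ?_ ?_ ?_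
    · filter_upwards [Metric.ball_mem_nhds z one_pos] with w hw
      refine .of_forall fun x hx => ?_
      rw [Set.uIoc_of_le hL.le] at hx
      have hx' : x ∈ Set.Icc 0 L := ⟨hx.1.le, hx.2⟩
      obtain ⟨hA, hB⟩ := hab w hw x hx'
      obtain ⟨hC, hD⟩ := hcd' w hw x hx'
      have aux : ∀ (m r A s B : ℂ) (K : ℝ), ‖A‖ ≤ K → ‖B‖ ≤ K →
          ‖m * (r * A + s * B)‖ ≤ ‖m‖ * (‖r‖ * K + ‖s‖ * K) := by
        intro m r A s B K hA hB
        rw [norm_mul]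
        gcongr
        refine (norm_add_le _ _).trans ?_
        rw [norm_mul, norm_mul]
        gcongr
      refine (norm_sub_le _ _).trans (add_le_add ((norm_add_le _ _).trans (add_le_add
        ((norm_sub_le _ _).trans (add_le_add ?_ ?_)) ?_)) ?_) <;> exact aux _ _ _ _ _ _ ‹_› ‹_›
    · have := hca z; have := hcb z; have := hcc z; have := hcd z
      exact Continuous.intervalIntegrable (by fun_prop) _ _
    · refine .of_forall fun x hx => ?_
      rw [Set.uIoc_of_le hL.le] at hx
      have hx' : x ∈ Set.Icc 0 L := ⟨hx.1.le, hx.2⟩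
      obtain ⟨hA, hB⟩ := continuousAt_of_solvesZS hq h₁ (by simp) (by simp) ha hb z hx'
      obtain ⟨hC, hD⟩ := continuousAt_of_solvesZS hq h₂ (by simp) (by simp) hc hd z hx'
      fun_prop
  have hFz : (∫ x in 0..L, ((a z L - d z L) * (a z x * d z x + b z x * c z x)
        - 2 * c z L * (a z x * b z x) + 2 * b z L * (c z x * d z x))) = ∫ x in 0..L, F z x := by
    congr 1; ext x; simp only [F]; ring
  rw [hFz, hasDerivAt_iff_tendsto_slope]
  refine (hG.tendsto.mono_left nhdsWithin_le_nhds).congr' ?_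
  filter_upwards [self_mem_nhdsWithin] with w hw
  rw [slope_def_field, hvar, mul_div_cancel_left₀ _ (sub_ne_zero.2 hw)]

/-- An elliptic monodromy matrix `[[m, conj n], [n, conj m]]` pairs definitely with the matrices
`Y⁻¹ σ₃ Y`, where `Y = [[a, conj b], [b, conj a]]`. -/
theorem im_mul_pairing_pos {m n a b : ℂ} (hmn : Complex.normSq n < m.im ^ 2) (ha : a ≠ 0) :
    0 < m.im * (m.im * (Complex.normSq a + Complex.normSq b)
      - 2 * ((starRingEnd ℂ) n * (a * b)).im) := by
  have hn : ‖n‖ < |m.im| := by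
    rw [Complex.normSq_eq_norm_sq, sq_lt_sq, abs_norm] at hmn
    exact hmn
  have ht : |((starRingEnd ℂ) n * (a * b)).im| ≤ ‖n‖ * (‖a‖ * ‖b‖) := by
    refine (Complex.abs_im_le_norm _).trans ?_
    simp
  simp only [Complex.normSq_eq_norm_sq]
  have ha' : 0 < ‖a‖ := norm_pos_iff.2 ha
  have hs : 0 < ‖a‖ ^ 2 + ‖b‖ ^ 2 := by positivity
  have hm : 0 < |m.im| := (norm_nonneg n).trans_lt hn
  have hlt : 2 * |((starRingEnd ℂ) n * (a * b)).im| < |m.im| * (‖a‖ ^ 2 + ‖b‖ ^ 2) := by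
    calc 2 * |((starRingEnd ℂ) n * (a * b)).im| ≤ 2 * (‖n‖ * (‖a‖ * ‖b‖)) := by gcongr
      _ = ‖n‖ * (2 * ‖a‖ * ‖b‖) := by ring
      _ ≤ ‖n‖ * (‖a‖ ^ 2 + ‖b‖ ^ 2) := by gcongr; exact two_mul_le_add_sq _ _
      _ < _ := by gcongr
  have hle := le_abs_self (m.im * ((starRingEnd ℂ) n * (a * b)).im)
  rw [abs_mul] at hle
  have hpos := mul_pos hm (sub_pos.2 hlt)
  nlinarith [abs_mul_abs_self m.im]

/-- for real `z` in the interior of a spectral band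
(`Δ(z)` real with `−1 < Δ(z) < 1`), one has `Δ'(z) ≠ 0`. -/
theorem discriminant_derivative_nonzero_in_band
    (L : ℝ) (hL : 0 < L)
    (q : ℝ → ℂ) (hq : Continuous q) (hper : ∀ x, q (x + L) = q x)
    (Y : ℂ → ℝ → Matrix (Fin 2) (Fin 2) ℂ)
    (hY0 : ∀ z, Y z 0 = 1)
    (hODE : ∀ (z : ℂ) (x : ℝ) (i j : Fin 2),
      HasDerivAt (fun t => Y z t i j)
        ((((-(Complex.I * z)) • sigma3 + Qmat q x) * Y z x) i j) x) :
    ∀ z : ℝ, ((Y (z : ℂ) L).trace / 2).im = 0 →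
      -1 < ((Y (z : ℂ) L).trace / 2).re → ((Y (z : ℂ) L).trace / 2).re < 1 →
      deriv (fun w => (Y w L).trace / 2) (z : ℂ) ≠ 0 := by
  intro z _ hgt hlt
  have h₁ : ∀ w, SolvesForcedZS q w 0 0 (fun x => Y w x 0 0) (fun x => Y w x 1 0) := fun w =>
    ⟨fun x => (hODE w x 0 0).congr_deriv
        (by simp [Matrix.mul_apply, Fin.sum_univ_two, sigma3, Qmat]),
      fun x => (hODE w x 1 0).congr_deriv
        (by simp [Matrix.mul_apply, Fin.sum_univ_two, sigma3, Qmat])⟩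
  have h₂ : ∀ w, SolvesForcedZS q w 0 0 (fun x => Y w x 0 1) (fun x => Y w x 1 1) := fun w =>
    ⟨fun x => (hODE w x 0 1).congr_deriv
        (by simp [Matrix.mul_apply, Fin.sum_univ_two, sigma3, Qmat]),
      fun x => (hODE w x 1 1).congr_deriv
        (by simp [Matrix.mul_apply, Fin.sum_univ_two, sigma3, Qmat])⟩
  have hderiv := hasDerivAt_trace_of_solvesZS hq hL h₁ h₂ (by simp [hY0]) (by simp [hY0])
    (by simp [hY0]) (by simp [hY0]) z
  have hsymm : ∀ x ∈ Set.Icc 0 L, Y z x 1 1 = (starRingEnd ℂ) (Y z x 0 0) ∧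
      Y z x 0 1 = (starRingEnd ℂ) (Y z x 1 0) := fun x hx =>
    (h₁ z).conj_symm hq (h₂ z) (by simp [hY0]) (by simp [hY0]) (by simp [hY0]) (by simp [hY0]) hx
  have hdet : ∀ x ∈ Set.Icc 0 L, Complex.normSq (Y z x 0 0) - Complex.normSq (Y z x 1 0) = 1 := by
    intro x hx
    have h := (h₁ z).det_eq (h₂ z) x
    simp only [hY0, (hsymm x hx).1, (hsymm x hx).2, Complex.mul_conj] at h
    exact_mod_cast (by simpa using h :
      (Complex.normSq (Y z x 0 0) : ℂ) - Complex.normSq (Y z x 1 0) = 1)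
  have hLmem : L ∈ Set.Icc 0 L := ⟨hL.le, le_rfl⟩
  obtain ⟨hdL, hcL⟩ := hsymm L hLmem
  have hdetL := hdet L hLmem
  set m := Y z L 0 0
  set n := Y z L 1 0
  have htr : ((Y (z : ℂ) L).trace / 2).re = m.re := by
    rw [Matrix.trace_fin_two, hdL, Complex.add_conj]
    simp [m]
  rw [htr] at hgt hlt
  have hmn : Complex.normSq n < m.im ^ 2 := by
    rw [Complex.normSq_apply m] at hdetL
    nlinarith
  let r : ℝ → ℝ := fun x => m.im * (Complex.normSq (Y z x 0 0) + Complex.normSq (Y z x 1 0))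
    - 2 * ((starRingEnd ℂ) n * (Y z x 0 0 * Y z x 1 0)).im
  have hr : Continuous r := by
    have ha : Continuous fun x => Y z x 0 0 :=
      continuous_iff_continuousAt.2 fun x => ((h₁ z).fst x).continuousAt
    have hb : Continuous fun x => Y z x 1 0 :=
      continuous_iff_continuousAt.2 fun x => ((h₁ z).snd x).continuousAt
    have := Complex.continuous_normSq.comp ha
    have := Complex.continuous_normSq.comp hb
    have := Complex.continuous_im.comp (continuous_const.mul (ha.mul hb) :
      Continuous fun x => (starRingEnd ℂ) n * (Y z x 0 0 * Y z x 1 0))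
    simp only [Function.comp_def] at *
    fun_prop
  have hpos : 0 < ∫ x in 0..L, m.im * r x := by
    refine intervalIntegral.intervalIntegral_pos_of_pos_on
      ((continuous_const.mul hr).intervalIntegrable _ _) (fun x hx => ?_) hL
    refine im_mul_pairing_pos hmn fun h0 => ?_
    have h := hdet x ⟨hx.1.le, hx.2.le⟩
    rw [h0, map_zero] at h
    linarith [Complex.normSq_nonneg (Y z x 1 0)]
  have hintegral : (∫ x in 0..L, ((m - Y z L 1 1) * (Y z x 0 0 * Y z x 1 1 + Y z x 1 0 * Y z x 0 1)
      - 2 * Y z L 0 1 * (Y z x 0 0 * Y z x 1 0) + 2 * n * (Y z x 0 1 * Y z x 1 1))) =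
      2 * Complex.I * ((∫ x in 0..L, r x : ℝ) : ℂ) := by
    rw [← intervalIntegral.integral_ofReal, ← intervalIntegral.integral_const_mul]
    refine intervalIntegral.integral_congr fun x hx => ?_
    rw [Set.uIcc_of_le hL.le] at hx
    simp only [(hsymm x hx).1, (hsymm x hx).2, hdL, hcL, r]
    apply Complex.ext <;> simp [Complex.normSq_apply] <;> ring
  have hΔ : HasDerivAt (fun w => (Y w L).trace / 2) ((∫ x in 0..L, r x : ℝ) : ℂ) z := by
    simp only [Matrix.trace_fin_two]
    refine (hderiv.div_const 2).congr_deriv ?_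
    rw [hintegral]
    linear_combination (-((∫ x in 0..L, r x : ℝ) : ℂ)) * Complex.I_mul_I
  rw [hΔ.deriv]
  intro h0
  rw [intervalIntegral.integral_const_mul, Complex.ofReal_eq_zero.1 h0, mul_zero] at hpos
  exact hpos.false
end
end
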